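/- Let (A, L) be an extended complete spectral metric space, F = (f_1, …, f_k) a strictly contractive dual IFS on A with Λ := max_i dilup(f_i) < 1, φ₀ a state on A with C := max_i d_L(φ₀, φ₀ ∘ f_i) < ∞, and π weights with every π_i > 0. For each finite word ω suppose φ_ω is a state with φ_ω ∘ f_ω = φ_ω and d_L(φ₀, φ_ω) ≤ C/(1 − Λ). Define φ^M := Σ_{ω ∈ {1,…,k}^M} π_ω φ_ω and φ_M := (π·F*)^M(φ₀). Then d_L(φ^M, φ_M) ≤ C·Λ^M/(1 − Λ) for every M; consequently both sequences (φ^M) and (φ_M) are d_L-convergent with the same d_L-limit φ_π, and φ_π is the unique (π·F*)-self-similar state within finite d_L-distance of φ₀. -/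

import Mathlib

open Filter Topology
open scoped ComplexOrder ENNReal NNReal MultiplierAlgebra

noncomputable section

/-- A *state* on a C⋆-algebra: a continuous linear functional into `ℂ` that is nonnegative
on nonnegative elements and has norm `1`. -/
def IsState {E : Type*} [NormedAddCommGroup E] [NormedSpace ℂ E] [PartialOrder E]
    (φ : E →L[ℂ] ℂ) : Prop :=
  (∀ a : E, 0 ≤ a → 0 ≤ φ a) ∧ ‖φ‖ = 1

variable {A : Type*} [NonUnitalCStarAlgebra A] [PartialOrder A] [StarOrderedRing A]

/-- `L` is an extended seminorm on the self-adjoint part `A_sa` of `A`: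
`L (t • b) = |t| * L b` for real `t`, and `L (b + b') ≤ L b + L b'`. -/
def IsESeminorm (L : selfAdjoint A → ℝ≥0∞) : Prop :=
  (∀ (t : ℝ) (b : selfAdjoint A), L (t • b) = (‖t‖₊ : ℝ≥0∞) * L b) ∧
    ∀ b b' : selfAdjoint A, L (b + b') ≤ L b + L b'

/-- The spectral distance `d_L(φ, ψ) = sup { |φ b - ψ b| : b ∈ A_sa, L b ≤ 1 }`,
valued in `[0, ∞]`. -/
def dL (L : selfAdjoint A → ℝ≥0∞) (φ ψ : A → ℂ) : ℝ≥0∞ :=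
  ⨆ b : {b : selfAdjoint A // L b ≤ 1}, (‖φ (b.1 : A) - ψ (b.1 : A)‖₊ : ℝ≥0∞)

/-- An approximate identity for `A`: a net `(I n)` with `0 ≤ I n`, `‖I n‖ ≤ 1`, and
`‖I n * a - a‖ → 0`, `‖a * I n - a‖ → 0` for every `a : A`. -/
def IsApproxUnit {ι : Type*} [Preorder ι] (I : ι → A) : Prop :=
  (∀ n, 0 ≤ I n) ∧ (∀ n, ‖I n‖ ≤ 1) ∧
    ∀ a : A, Tendsto (fun n => ‖I n * a - a‖) atTop (𝓝 0) ∧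
      Tendsto (fun n => ‖a * I n - a‖) atTop (𝓝 0)

/-- A (self-adjoint valued) approximate identity `(I n)` for `A` along which `L` tends to `0`. -/
structure SpectralAUData (L : selfAdjoint A → ℝ≥0∞) where
  ι : Type
  [pre : Preorder ι]
  [ne : Nonempty ι]
  [dir : IsDirected ι (· ≤ ·)]
  I : ι → selfAdjoint A
  isAU : IsApproxUnit fun n => (I n : A)
  tendsto_L : Tendsto (fun n => L (I n)) atTop (𝓝 0)

/-- `(A, L)` is an extended complete spectral metric space: the finite-`L` self-adjoint
elements are dense, there is an approximate identity along which `L` tends to `0`, and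
`L` is norm-lower semicontinuous. -/
structure IsECSMS (L : selfAdjoint A → ℝ≥0∞) : Prop where
  seminorm : IsESeminorm L
  dense_finite : Dense {b : selfAdjoint A | L b < ⊤}
  lsc : LowerSemicontinuous L
  approxUnit : Nonempty (SpectralAUData L)

/-- A witness that the `*`-homomorphism `f : A → A` is proper: an approximate identity
whose image under `f` is again an approximate identity. -/
structure ProperWitness (f : A →⋆ₙₐ[ℂ] A) where
  ι : Type
  [pre : Preorder ι]
  [ne : Nonempty ι]
  [dir : IsDirected ι (· ≤ ·)]
  I : ι → A
  isAU : IsApproxUnit I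
  isAU_map : IsApproxUnit fun n => f (I n)

/-- A `*`-homomorphism `f : A → A` is proper if there is an approximate identity `(I n)`
for `A` such that `(f (I n))` is again an approximate identity for `A`. -/
def IsProperHom (f : A →⋆ₙₐ[ℂ] A) : Prop := Nonempty (ProperWitness f)

/-- The upper dilation factor `dilup f = sup { L (f b) : b ∈ A_sa, L b ≤ 1 }`. -/
def dilup (L : selfAdjoint A → ℝ≥0∞) (f : A →⋆ₙₐ[ℂ] A) : ℝ≥0∞ :=
  ⨆ b : {b : selfAdjoint A // L b ≤ 1}, L ⟨f (b.1 : A), b.1.2.map f⟩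

/-- The dual operator `(π·F*) φ = Σ_i π_i (φ ∘ f_i)` acting on `ℂ`-valued functionals. -/
def piF {k : ℕ} (f : Fin k → A →⋆ₙₐ[ℂ] A) (π : Fin k → ℝ≥0) (φ : A → ℂ) : A → ℂ :=
  fun a => ∑ i, ((π i : ℝ) : ℂ) * φ (f i a)

/-- For a finite word `ω = (ω 0, …, ω (M-1))`, the composite `f_ω = f_{ω 0} ∘ … ∘ f_{ω (M-1)}`. -/
def wordMapF {k : ℕ} (f : Fin k → A →⋆ₙₐ[ℂ] A) : (M : ℕ) → (Fin M → Fin k) → A → A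
  | 0, _, a => a
  | M + 1, ω, a => wordMapF f M (fun i => ω i.castSucc) (f (ω (Fin.last M)) a)

theorem dL_le_iff {L : selfAdjoint A → ℝ≥0∞} {φ ψ : A → ℂ} {r : ℝ≥0∞} :
    dL L φ ψ ≤ r ↔ ∀ b : selfAdjoint A, L b ≤ 1 → edist (φ b) (ψ b) ≤ r := by
  simp [dL, edist_eq_enorm_sub, enorm]

theorem edist_le_dL {L : selfAdjoint A → ℝ≥0∞} (φ ψ : A → ℂ) {b : selfAdjoint A} (hb : L b ≤ 1) :
    edist (φ b) (ψ b) ≤ dL L φ ψ :=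
  dL_le_iff.1 le_rfl b hb

theorem dL_comm (L : selfAdjoint A → ℝ≥0∞) (φ ψ : A → ℂ) : dL L φ ψ = dL L ψ φ :=
  le_antisymm (dL_le_iff.2 fun _ hb => edist_comm (α := ℂ) _ _ ▸ edist_le_dL ψ φ hb)
    (dL_le_iff.2 fun _ hb => edist_comm (α := ℂ) _ _ ▸ edist_le_dL φ ψ hb)

theorem dL_triangle (L : selfAdjoint A → ℝ≥0∞) (φ χ ψ : A → ℂ) :
    dL L φ ψ ≤ dL L φ χ + dL L χ ψ :=
  dL_le_iff.2 fun _ hb => (edist_triangle _ (χ _) _).trans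
    (add_le_add (edist_le_dL φ χ hb) (edist_le_dL χ ψ hb))

theorem dL_sum_le (L : selfAdjoint A → ℝ≥0∞) {ι : Type*} (s : Finset ι) (c : ι → ℝ≥0)
    (φ ψ : ι → A → ℂ) :
    dL L (fun a => ∑ i ∈ s, ((c i : ℝ) : ℂ) * φ i a) (fun a => ∑ i ∈ s, ((c i : ℝ) : ℂ) * ψ i a) ≤
      ∑ i ∈ s, c i * dL L (φ i) (ψ i) := by
  refine dL_le_iff.2 fun b hb => ?_
  rw [edist_eq_enorm_sub, ← Finset.sum_sub_distrib]
  refine (enorm_sum_le _ _).trans (Finset.sum_le_sum fun i _ => ?_)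
  rw [← mul_sub, enorm_mul, ← edist_eq_enorm_sub]
  refine mul_le_mul' (le_of_eq ?_) (edist_le_dL _ _ hb)
  simp [enorm]

theorem dL_convex_le (L : selfAdjoint A → ℝ≥0∞) {ι : Type*} [Fintype ι] {c : ι → ℝ≥0}
    (hc : ∑ i, c i = 1) {φ ψ : ι → A → ℂ} {r : ℝ≥0∞} (h : ∀ i, dL L (φ i) (ψ i) ≤ r) :
    dL L (fun a => ∑ i, ((c i : ℝ) : ℂ) * φ i a) (fun a => ∑ i, ((c i : ℝ) : ℂ) * ψ i a) ≤ r :=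
  calc
    _ ≤ ∑ i, (c i : ℝ≥0∞) * dL L (φ i) (ψ i) := dL_sum_le L _ c φ ψ
    _ ≤ ∑ i, (c i : ℝ≥0∞) * r := by gcongr with i; exact h i
    _ = r := by rw [← Finset.sum_mul, ← ENNReal.ofNNReal_finsetSum, hc]; simp

theorem edist_le_mul_dL {L : selfAdjoint A → ℝ≥0∞} (hL : IsESeminorm L) {φ ψ : A →L[ℂ] ℂ}
    (hd : dL L φ ψ ≠ ⊤) {b : selfAdjoint A} (hb : L b ≠ ⊤) :
    edist (φ b) (ψ b) ≤ L b * dL L φ ψ := by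
  refine ENNReal.le_mul_of_forall_lt (Or.inr hd) (Or.inl hb) fun r hr d hd' => ?_
  rcases eq_or_ne r ⊤ with rfl | hr'
  · rw [ENNReal.top_mul (ne_bot_of_gt hd')]
    exact le_top
  lift r to ℝ≥0 using hr'
  have hr0 : r ≠ 0 := by rintro rfl; simp at hr
  have hscale : L ((r⁻¹ : ℝ) • b) ≤ 1 := by
    rw [hL.1, nnnorm_inv, ENNReal.coe_inv (by simpa using hr0), NNReal.nnnorm_eq]
    calc (r : ℝ≥0∞)⁻¹ * L b ≤ (r : ℝ≥0∞)⁻¹ * r := by gcongr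
      _ = 1 := ENNReal.inv_mul_cancel (by simpa using hr0) (by simp)
  have h := edist_le_dL φ ψ hscale
  have hsmul : ∀ χ : A →L[ℂ] ℂ,
      χ (((r⁻¹ : ℝ) • b : selfAdjoint A) : A) = ((r⁻¹ : ℝ) : ℂ) * χ b := fun χ => by
    rw [selfAdjoint.val_smul, ← Complex.coe_smul, map_smul, smul_eq_mul]
  rw [hsmul, hsmul, edist_eq_enorm_sub, ← mul_sub, enorm_mul, ← edist_eq_enorm_sub] at h
  have hr1 : ‖((r⁻¹ : ℝ) : ℂ)‖ₑ = (r : ℝ≥0∞)⁻¹ := by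
    rw [← ENNReal.coe_inv hr0]
    simp [enorm]
  rw [hr1, mul_comm, ← div_eq_mul_inv,
    ENNReal.div_le_iff (by simpa using hr0) (by simp), mul_comm] at h
  exact h.trans (by gcongr)

/-- A `*`-homomorphism as a continuous linear map. -/
def homCLM (g : A →⋆ₙₐ[ℂ] A) : A →L[ℂ] A :=
  LinearMap.mkContinuous
    { toFun := g
      map_add' := map_add g
      map_smul' := map_smul g } 1 fun a => by
    simpa using NonUnitalStarAlgHom.norm_apply_le g a

@[simp]
theorem homCLM_apply (g : A →⋆ₙₐ[ℂ] A) (a : A) : homCLM g a = g a := rfl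

theorem dL_comp_le {L : selfAdjoint A → ℝ≥0∞} (hL : IsESeminorm L) {g : A →⋆ₙₐ[ℂ] A}
    {r : ℝ≥0∞} (hg : dilup L g ≤ r) (hr : r ≠ ⊤) {φ ψ : A →L[ℂ] ℂ} (hd : dL L φ ψ ≠ ⊤) :
    dL L (fun a => φ (g a)) (fun a => ψ (g a)) ≤ r * dL L φ ψ := by
  refine dL_le_iff.2 fun b hb => ?_
  have hgb : L ⟨g (b : A), b.2.map g⟩ ≤ r :=
    (le_iSup (fun b : {b : selfAdjoint A // L b ≤ 1} => L ⟨g (b.1 : A), b.1.2.map g⟩)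
      ⟨b, hb⟩).trans hg
  refine (edist_le_mul_dL hL hd (b := ⟨g (b : A), b.2.map g⟩) (ne_top_of_le_ne_top hr hgb)).trans ?_
  gcongr

/-- The composite `f_ω` as a `*`-homomorphism. -/
def wordHom {k : ℕ} (f : Fin k → A →⋆ₙₐ[ℂ] A) : (M : ℕ) → (Fin M → Fin k) → A →⋆ₙₐ[ℂ] A
  | 0, _ => NonUnitalStarAlgHom.id ℂ A
  | M + 1, ω => (wordHom f M fun i => ω i.castSucc).comp (f (ω (Fin.last M)))

theorem wordHom_apply {k : ℕ} (f : Fin k → A →⋆ₙₐ[ℂ] A) (M : ℕ) (ω : Fin M → Fin k) (a : A) :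
    wordHom f M ω a = wordMapF f M ω a := by
  induction M generalizing a with
  | zero => rfl
  | succ M ih => exact ih _ _

theorem dL_wordMapF_le {L : selfAdjoint A → ℝ≥0∞} (hL : IsESeminorm L) {k : ℕ}
    {f : Fin k → A →⋆ₙₐ[ℂ] A} {Λ : ℝ≥0∞} (hf : ∀ i, dilup L (f i) ≤ Λ) (hΛ : Λ ≠ ⊤)
    {φ ψ : A →L[ℂ] ℂ} (hd : dL L φ ψ ≠ ⊤) (M : ℕ) (ω : Fin M → Fin k) :
    dL L (fun a => φ (wordMapF f M ω a)) (fun a => ψ (wordMapF f M ω a)) ≤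
      Λ ^ M * dL L φ ψ := by
  induction M with
  | zero => simp [wordMapF]
  | succ M ih =>
    have h := ih fun i => ω i.castSucc
    simp_rw [← wordHom_apply] at h
    refine (dL_comp_le hL (hf (ω (Fin.last M))) hΛ
      (φ := φ.comp (homCLM (wordHom f M fun i => ω i.castSucc)))
      (ψ := ψ.comp (homCLM (wordHom f M fun i => ω i.castSucc)))
      (ne_top_of_le_ne_top (ENNReal.mul_ne_top (ENNReal.pow_ne_top hΛ) hd) h) |>.trans
        (mul_le_mul_right h Λ)).trans_eq' ?_ |>.trans_eq ?_
    · simp [wordMapF, wordHom_apply]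
    · ring

theorem piF_iterate_eq_sum {k : ℕ} (f : Fin k → A →⋆ₙₐ[ℂ] A) (π : Fin k → ℝ≥0) (φ : A → ℂ)
    (M : ℕ) (a : A) :
    (piF f π)^[M] φ a =
      ∑ ω : Fin M → Fin k, (((∏ i, π (ω i) : ℝ≥0) : ℝ) : ℂ) * φ (wordMapF f M ω a) := by
  induction M generalizing a with
  | zero => simp [wordMapF]
  | succ M ih =>
    rw [Function.iterate_succ_apply', piF, ← (Fin.snocEquiv fun _ => Fin k).sum_comp,
      Fintype.sum_prod_type]
    refine Finset.sum_congr rfl fun i _ => ?_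
    rw [ih, Finset.mul_sum]
    refine Finset.sum_congr rfl fun ω _ => ?_
    simp [wordMapF, Fin.snocEquiv, Fin.prod_univ_castSucc]
    ring

theorem sum_prod_word_eq_one {k : ℕ} {π : Fin k → ℝ≥0} (hπ : ∑ i, π i = 1) (M : ℕ) :
    ∑ ω : Fin M → Fin k, ∏ i, π (ω i) = 1 := by
  have h := Finset.prod_univ_sum (fun _ : Fin M => (Finset.univ : Finset (Fin k))) fun _ i => π i
  simpa [hπ] using h.symm

/-- The dual operator `π·F*` acting on continuous linear functionals. -/
def piFCLM {k : ℕ} (f : Fin k → A →⋆ₙₐ[ℂ] A) (π : Fin k → ℝ≥0) (φ : A →L[ℂ] ℂ) : A →L[ℂ] ℂ :=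
  ∑ i, ((π i : ℝ) : ℂ) • φ.comp (homCLM (f i))

theorem coe_piFCLM {k : ℕ} (f : Fin k → A →⋆ₙₐ[ℂ] A) (π : Fin k → ℝ≥0) (φ : A →L[ℂ] ℂ) :
    ⇑(piFCLM f π φ) = piF f π φ := by
  ext a
  simp [piFCLM, piF]

theorem coe_piFCLM_iterate {k : ℕ} (f : Fin k → A →⋆ₙₐ[ℂ] A) (π : Fin k → ℝ≥0)
    (φ : A →L[ℂ] ℂ) (M : ℕ) : ⇑((piFCLM f π)^[M] φ) = (piF f π)^[M] φ :=
  Function.Semiconj.iterate_right (coe_piFCLM f π) M φ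

theorem dL_piF_le {L : selfAdjoint A → ℝ≥0∞} (hL : IsESeminorm L) {k : ℕ}
    {f : Fin k → A →⋆ₙₐ[ℂ] A} {Λ : ℝ≥0∞} (hf : ∀ i, dilup L (f i) ≤ Λ) (hΛ : Λ ≠ ⊤)
    {π : Fin k → ℝ≥0} (hπ : ∑ i, π i = 1) {φ ψ : A →L[ℂ] ℂ} (hd : dL L φ ψ ≠ ⊤) :
    dL L (piF f π φ) (piF f π ψ) ≤ Λ * dL L φ ψ :=
  dL_convex_le L hπ fun i => dL_comp_le hL (hf i) hΛ hd

theorem piF_nonneg {k : ℕ} (f : Fin k → A →⋆ₙₐ[ℂ] A) (π : Fin k → ℝ≥0) {φ : A → ℂ}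
    (hφ : ∀ a, 0 ≤ a → 0 ≤ φ a) (a : A) (ha : 0 ≤ a) : 0 ≤ piF f π φ a :=
  Finset.sum_nonneg fun i _ => mul_nonneg (by exact_mod_cast (π i).2) (hφ _ (map_nonneg (f i) ha))

theorem norm_piFCLM_le {k : ℕ} (f : Fin k → A →⋆ₙₐ[ℂ] A) {π : Fin k → ℝ≥0}
    (hπ : ∑ i, π i = 1) (φ : A →L[ℂ] ℂ) : ‖piFCLM f π φ‖ ≤ ‖φ‖ := by
  refine ContinuousLinearMap.opNorm_le_bound _ (norm_nonneg _) fun a => ?_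
  rw [coe_piFCLM]
  calc
    ‖piF f π φ a‖ ≤ ∑ i, ‖((π i : ℝ) : ℂ) * φ (f i a)‖ := norm_sum_le _ _
    _ ≤ ∑ i, (π i : ℝ) * (‖φ‖ * ‖a‖) := by
      refine Finset.sum_le_sum fun i _ => ?_
      rw [norm_mul, Complex.norm_real, NNReal.norm_eq]
      gcongr
      exact φ.le_of_opNorm_le_of_le le_rfl (NonUnitalStarAlgHom.norm_apply_le (f i) a)
    _ = ‖φ‖ * ‖a‖ := by
      rw [← Finset.sum_mul, ← NNReal.coe_sum, hπ, NNReal.coe_one, one_mul]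

theorem eq_of_dL_eq_zero {L : selfAdjoint A → ℝ≥0∞} (hL : IsECSMS L) {φ ψ : A →L[ℂ] ℂ}
    (h : dL L φ ψ = 0) : φ = ψ := by
  have hsa : ∀ b : selfAdjoint A, φ b = ψ b := fun b => by
    refine congrFun (Continuous.ext_on hL.dense_finite (f := fun b : selfAdjoint A => φ b)
      (g := fun b : selfAdjoint A => ψ b) (by fun_prop) (by fun_prop) fun b hb => ?_) b
    have := edist_le_mul_dL hL.seminorm (φ := φ) (ψ := ψ) (by simp [h]) (ne_of_lt hb)
    simpa [h] using this
  ext a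
  rw [← realPart_add_I_smul_imaginaryPart a]
  simp [hsa]

theorem norm_sq_le_of_nonneg {φ : A →L[ℂ] ℂ} (hφ : ∀ a, 0 ≤ a → 0 ≤ φ a) {e : A} (he : 0 ≤ e)
    (he1 : ‖e‖ ≤ 1) (a : A) : ‖φ (e * a)‖ ^ 2 ≤ ‖φ e‖ * (‖φ‖ * ‖a‖ ^ 2) := by
  let p : A →ₚ[ℂ] ℂ := PositiveLinearMap.mk₀ φ.toLinearMap hφ
  have hp : ∀ x, p x = φ x := fun _ => rfl
  have hnorm : ∀ x : A, ‖p.toPreGNS x‖ ^ 2 = ‖φ (star x * x)‖ := fun x => by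
    have h := congrArg norm (p.preGNS_norm_sq (p.toPreGNS x))
    simpa [hp] using h
  set s := CFC.sqrt e
  have hss : s * s = e := CFC.sqrt_mul_sqrt_self e he
  have hsa : star s = s := (CFC.sqrt_nonneg e).isSelfAdjoint
  have hcs := norm_inner_le_norm (𝕜 := ℂ) (p.toPreGNS s) (p.toPreGNS (s * a))
  rw [PositiveLinearMap.preGNS_inner_def] at hcs
  simp only [PositiveLinearMap.ofPreGNS_toPreGNS, hp, hsa, ← mul_assoc, hss] at hcs
  calc
    ‖φ (e * a)‖ ^ 2 ≤ (‖p.toPreGNS s‖ * ‖p.toPreGNS (s * a)‖) ^ 2 := by gcongr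
    _ = ‖φ e‖ * ‖φ (star a * (e * a))‖ := by
      rw [mul_pow, hnorm, hnorm, star_mul, hsa, hss, mul_assoc, ← mul_assoc s s a, hss]
    _ ≤ ‖φ e‖ * (‖φ‖ * ‖a‖ ^ 2) := by
      gcongr
      refine φ.le_of_opNorm_le_of_le le_rfl ?_
      calc
        ‖star a * (e * a)‖ ≤ ‖star a‖ * (‖e‖ * ‖a‖) :=
          (norm_mul_le _ _).trans (by gcongr; exact norm_mul_le _ _)
        _ ≤ ‖a‖ * (1 * ‖a‖) := by rw [norm_star]; gcongr
        _ = ‖a‖ ^ 2 := by ring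

theorem IsState.eventually_lt_norm {φ : A →L[ℂ] ℂ} (hφ : IsState φ) {ι : Type*} [Preorder ι]
    {I : ι → A} (hI : IsApproxUnit I) {r : ℝ} (hr : r < 1) : ∀ᶠ n in atTop, r < ‖φ (I n)‖ := by
  wlog hr0 : 0 ≤ r generalizing r
  · exact Eventually.of_forall fun n => (not_le.1 hr0).trans_le (norm_nonneg _)
  have hsqrt : √r < ‖φ‖ := by
    rw [hφ.2]
    exact (Real.sqrt_lt' one_pos).2 (by simpa using hr)
  obtain ⟨a, ha1, ha⟩ := φ.exists_lt_apply_of_lt_opNorm hsqrt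
  have hconv : Tendsto (fun n => ‖φ (I n * a)‖) atTop (𝓝 ‖φ a‖) :=
    ((φ.continuous.tendsto a).comp (tendsto_iff_norm_sub_tendsto_zero.2 (hI.2.2 a).1)).norm
  filter_upwards [hconv.eventually_const_lt ha] with n hn
  have h := norm_sq_le_of_nonneg hφ.1 (hI.1 n) (hI.2.1 n) a
  rw [hφ.2, one_mul] at h
  have h1 : r < ‖φ (I n * a)‖ ^ 2 := (Real.sqrt_lt' ((Real.sqrt_nonneg r).trans_lt hn)).1 hn
  have h2 : ‖φ (I n)‖ * ‖a‖ ^ 2 ≤ ‖φ (I n)‖ :=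
    mul_le_of_le_one_right (norm_nonneg _) (pow_le_one₀ (norm_nonneg a) ha1.le)
  linarith

theorem cauchySeq_apply_of_dense {φ : ℕ → A →L[ℂ] ℂ} (hφ : ∀ n, ‖φ n‖ ≤ 1)
    {s : Set (selfAdjoint A)} (hs : Dense s) (hc : ∀ b ∈ s, CauchySeq fun n => φ n (b : A))
    (a : A) : CauchySeq fun n => φ n a := by
  have hsa : ∀ b : selfAdjoint A, CauchySeq fun n => φ n (b : A) := fun b => by
    refine Metric.cauchySeq_iff'.2 fun ε hε => ?_
    obtain ⟨c, hcs, hbc⟩ := Metric.mem_closure_iff.1 (hs b) (ε / 3) (by positivity)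
    obtain ⟨N, hN⟩ := Metric.cauchySeq_iff'.1 (hc c hcs) (ε / 3) (by positivity)
    refine ⟨N, fun n hn => ?_⟩
    have key : ∀ m, dist (φ m (b : A)) (φ m (c : A)) < ε / 3 := fun m => by
      rw [dist_eq_norm, ← map_sub]
      refine lt_of_le_of_lt ((φ m).le_of_opNorm_le (hφ m) _) ?_
      rw [one_mul, ← dist_eq_norm]
      exact hbc
    have h1 := key n
    have h2 := key N
    have h3 := hN n hn
    have h4 := dist_triangle4 (φ n (b : A)) (φ n (c : A)) (φ N (c : A)) (φ N (b : A))
    rw [dist_comm (φ N (c : A))] at h4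
    linarith
  have h := (hsa (realPart a)).add
    ((uniformContinuous_const_smul Complex.I).comp_cauchySeq (hsa (imaginaryPart a)))
  convert h using 2 with n
  conv_lhs => rw [← realPart_add_I_smul_imaginaryPart a]
  simp

/-- A `d_L`-geometrically Cauchy sequence of positive contractive functionals starting at a state
converges pointwise, and in `d_L`, to a state. -/
theorem exists_isState_tendsto {L : selfAdjoint A → ℝ≥0∞} (hL : IsECSMS L)
    {φ : ℕ → A →L[ℂ] ℂ} (hpos : ∀ n a, 0 ≤ a → 0 ≤ φ n a) (hnorm : ∀ n, ‖φ n‖ ≤ 1)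
    (h0 : IsState (φ 0)) {C Λ : ℝ≥0∞} (hC : C ≠ ⊤) (hΛ : Λ < 1)
    (hd : ∀ n, dL L (φ n) (φ (n + 1)) ≤ C * Λ ^ n) :
    ∃ ψ : A →L[ℂ] ℂ, IsState ψ ∧ (∀ a, Tendsto (fun n => φ n a) atTop (𝓝 (ψ a))) ∧
      ∀ n, dL L (φ n) ψ ≤ C * Λ ^ n / (1 - Λ) := by
  have hcauchy : ∀ a, CauchySeq fun n => φ n a := by
    refine cauchySeq_apply_of_dense hnorm hL.dense_finite fun b hb => ?_
    refine cauchySeq_of_edist_le_geometric Λ (L b * C) hΛ (ENNReal.mul_ne_top (ne_of_lt hb) hC)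
      fun n => ?_
    rw [mul_assoc]
    refine (edist_le_mul_dL hL.seminorm (ne_top_of_le_ne_top (ENNReal.mul_ne_top hC
      (ENNReal.pow_ne_top hΛ.ne_top)) (hd n)) (ne_of_lt hb)).trans ?_
    gcongr
    exact hd n
  choose g hg using fun a => cauchySeq_tendsto_of_complete (hcauchy a)
  let ψ : A →L[ℂ] ℂ := (linearMapOfTendsto g (fun n => (φ n : A →ₗ[ℂ] ℂ))
    (tendsto_pi_nhds.2 hg)).mkContinuous 1 fun a =>
      le_of_tendsto (hg a).norm (Eventually.of_forall fun n => (φ n).le_of_opNorm_le (hnorm n) a)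
  have hψ : ∀ a, Tendsto (fun n => φ n a) atTop (𝓝 (ψ a)) := hg
  have hdist : ∀ n, dL L (φ n) ψ ≤ C * Λ ^ n / (1 - Λ) := fun n => dL_le_iff.2 fun b hb =>
    edist_le_of_edist_le_geometric_of_tendsto Λ C
      (fun m => (edist_le_dL _ _ hb).trans (hd m)) (hψ b) n
  have hψ1 : ‖ψ‖ ≤ 1 := LinearMap.mkContinuous_norm_le _ zero_le_one _
  refine ⟨ψ, ⟨fun a ha => ge_of_tendsto' (hψ a) fun n => hpos n a ha, hψ1.antisymm ?_⟩, hψ, hdist⟩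
  obtain ⟨ι, I, hI, hIL⟩ := hL.approxUnit
  have hd0 : dL L (φ 0) ψ ≠ ⊤ := by
    refine ne_top_of_le_ne_top ?_ (hdist 0)
    have := (tsub_pos_iff_lt.2 hΛ).ne'
    finiteness
  refine le_of_forall_pos_lt_add fun ε hε => ?_
  have hsmall : Tendsto (fun n => L (I n) * dL L (φ 0) ψ) atTop (𝓝 0) := by
    simpa using ENNReal.Tendsto.mul_const hIL (Or.inr hd0)
  obtain ⟨n, hn1, hn2, hn3⟩ := ((h0.eventually_lt_norm hI
    (show 1 - ε / 2 < 1 by linarith)).and ((hsmall.eventually_lt_const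
      (ENNReal.ofReal_pos.2 (half_pos hε))).and (hIL.eventually_lt_const ENNReal.zero_lt_top))).exists
  have hclose := (edist_le_mul_dL hL.seminorm hd0 hn3.ne).trans_lt hn2
  rw [edist_lt_ofReal, dist_eq_norm] at hclose
  have h1 : ‖ψ (I n : A)‖ ≤ ‖ψ‖ := by
    simpa using ψ.le_of_opNorm_le_of_le le_rfl (hI.2.1 n)
  have h2 := norm_sub_norm_le (φ 0 (I n : A)) (ψ (I n : A))
  linarith

/-- Representation formula: the convex combinations `φ^M = Σ_ω π_ω φ_ω` of fixed states of
the words of length `M` and the iterates `φ_M = (π·F*)^M(φ₀)` satisfy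
`d_L(φ^M, φ_M) ≤ C Λ^M / (1-Λ)`; both sequences `d_L`-converge to the same limit `φ_π`,
which is the unique `(π·F*)`-self-similar state at finite `d_L`-distance from `φ₀`. -/
theorem convexCombination_and_iterates_converge (L : selfAdjoint A → ℝ≥0∞)
    (hL : IsECSMS L)
    {k : ℕ} (f : Fin k → A →⋆ₙₐ[ℂ] A) (hf : ∀ i, IsProperHom (f i))
    (Λ C : ℝ≥0∞) (hΛdef : Λ = ⨆ i, dilup L (f i)) (hΛ : Λ < 1)
    (φ₀ : A →L[ℂ] ℂ) (hφ₀ : IsState φ₀)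
    (hCdef : C = ⨆ i, dL L ⇑φ₀ (fun a => φ₀ (f i a))) (hC : C < ⊤)
    (π : Fin k → ℝ≥0) (hπ : ∑ i, π i = 1) (hπpos : ∀ i, 0 < π i)
    (Φ : (M : ℕ) → (Fin M → Fin k) → (A →L[ℂ] ℂ))
    (hΦstate : ∀ M (ω : Fin M → Fin k), IsState (Φ M ω))
    (hΦfix : ∀ M (ω : Fin M → Fin k) (a : A), Φ M ω (wordMapF f M ω a) = Φ M ω a)
    (hΦdist : ∀ M (ω : Fin M → Fin k), dL L ⇑φ₀ ⇑(Φ M ω) ≤ C / (1 - Λ)) :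
    (∀ M : ℕ,
      dL L (fun a => ∑ ω : Fin M → Fin k, (((∏ i, π (ω i)) : ℝ) : ℂ) * Φ M ω a)
        ((piF f π)^[M] ⇑φ₀) ≤ C * Λ ^ M / (1 - Λ)) ∧
    ∃ φπ : A →L[ℂ] ℂ, IsState φπ ∧
      Tendsto (fun M =>
        dL L (fun a => ∑ ω : Fin M → Fin k, (((∏ i, π (ω i)) : ℝ) : ℂ) * Φ M ω a) ⇑φπ)
        atTop (𝓝 0) ∧
      Tendsto (fun M => dL L ((piF f π)^[M] ⇑φ₀) ⇑φπ) atTop (𝓝 0) ∧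
      (∀ a : A, φπ a = piF f π ⇑φπ a) ∧ dL L ⇑φ₀ ⇑φπ < ⊤ ∧
      ∀ ψ : A →L[ℂ] ℂ, IsState ψ → (∀ a : A, ψ a = piF f π ⇑ψ a) →
        dL L ⇑φ₀ ⇑ψ < ⊤ → ψ = φπ := by
  have hLs := hL.seminorm
  have hΛt : Λ ≠ ⊤ := hΛ.ne_top
  have hfΛ : ∀ i, dilup L (f i) ≤ Λ := fun i => hΛdef ▸ le_iSup (fun i => dilup L (f i)) i
  have hgap : 1 - Λ ≠ 0 := (tsub_pos_iff_lt.2 hΛ).ne'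
  have hCt : C / (1 - Λ) ≠ ⊤ := ENNReal.div_ne_top hC.ne hgap
  have hswap : ∀ M : ℕ, C * Λ ^ M / (1 - Λ) = Λ ^ M * (C / (1 - Λ)) := fun M => by
    rw [mul_comm C, mul_div_assoc]
  have hlim : Tendsto (fun M => C * Λ ^ M / (1 - Λ)) atTop (𝓝 0) := by
    simp_rw [hswap]
    simpa using ENNReal.Tendsto.mul_const (ENNReal.tendsto_pow_atTop_nhds_zero_of_lt_one hΛ)
      (Or.inr hCt)
  have hbound : ∀ M : ℕ,
      dL L (fun a => ∑ ω : Fin M → Fin k, (((∏ i, π (ω i)) : ℝ) : ℂ) * Φ M ω a)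
        ((piF f π)^[M] ⇑φ₀) ≤ C * Λ ^ M / (1 - Λ) := fun M => by
    simp_rw [← NNReal.coe_prod]
    rw [funext (piF_iterate_eq_sum f π φ₀ M), dL_comm, hswap]
    refine dL_convex_le L (sum_prod_word_eq_one hπ M) (ψ := fun ω => Φ M ω) fun ω => ?_
    have h := dL_wordMapF_le hLs hfΛ hΛt (ne_top_of_le_ne_top hCt (hΦdist M ω)) M ω
    simp_rw [hΦfix] at h
    exact h.trans (by gcongr; exact hΦdist M ω)
  have hstep : ∀ M, dL L ((piFCLM f π)^[M] φ₀) ((piFCLM f π)^[M + 1] φ₀) ≤ C * Λ ^ M := fun M => by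
    induction M with
    | zero =>
      rw [pow_zero, mul_one, Function.iterate_succ_apply', Function.iterate_zero_apply, coe_piFCLM]
      have h := dL_convex_le L hπ (φ := fun _ => φ₀) (ψ := fun i a => φ₀ (f i a)) (r := C)
        fun i => hCdef ▸ le_iSup (fun i => dL L φ₀ fun a => φ₀ (f i a)) i
      have hconst : (fun a => ∑ i, ((π i : ℝ) : ℂ) * φ₀ a) = φ₀ := funext fun a => by
        rw [← Finset.sum_mul, ← Complex.ofReal_sum, ← NNReal.coe_sum, hπ]
        simp
      rwa [hconst] at h
    | succ M ih =>
      rw [Function.iterate_succ_apply', Function.iterate_succ_apply' _ (M + 1), coe_piFCLM,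
        coe_piFCLM]
      refine (dL_piF_le hLs hfΛ hΛt hπ (ne_top_of_le_ne_top
        (ENNReal.mul_ne_top hC.ne (ENNReal.pow_ne_top hΛt)) ih)).trans ?_
      calc Λ * _ ≤ Λ * (C * Λ ^ M) := by gcongr
        _ = C * Λ ^ (M + 1) := by ring
  have hpos : ∀ M a, 0 ≤ a → 0 ≤ (piFCLM f π)^[M] φ₀ a := fun M => by
    induction M with
    | zero => exact hφ₀.1
    | succ M ih =>
      rw [Function.iterate_succ_apply', coe_piFCLM]
      exact piF_nonneg f π ih
  have hnorm : ∀ M, ‖(piFCLM f π)^[M] φ₀‖ ≤ 1 := fun M => by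
    induction M with
    | zero => exact hφ₀.2.le
    | succ M ih =>
      rw [Function.iterate_succ_apply']
      exact (norm_piFCLM_le f hπ _).trans ih
  obtain ⟨φπ, hstate, hpt, hdist⟩ := exists_isState_tendsto hL hpos hnorm hφ₀ hC.ne hΛ hstep
  simp_rw [coe_piFCLM_iterate] at hpt hdist
  have hfix : ∀ a : A, φπ a = piF f π φπ a := fun a => by
    refine tendsto_nhds_unique ((tendsto_add_atTop_iff_nat 1).2 (hpt a)) ?_
    simp_rw [Function.iterate_succ_apply']
    exact tendsto_finsetSum _ fun i _ => (hpt (f i a)).const_mul _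
  have hfin : dL L φ₀ φπ < ⊤ := (hdist 0).trans_lt (by
    rw [hswap, pow_zero, one_mul]
    exact hCt.lt_top)
  refine ⟨hbound, φπ, hstate, ?_, ?_, hfix, hfin, fun ψ _ hψ hψd => ?_⟩
  · refine tendsto_of_tendsto_of_tendsto_of_le_of_le tendsto_const_nhds
      (by simpa using hlim.add hlim) (fun _ => zero_le) fun M => ?_
    exact (dL_triangle L _ ((piF f π)^[M] φ₀) _).trans (add_le_add (hbound M) (hdist M))
  · exact tendsto_of_tendsto_of_tendsto_of_le_of_le tendsto_const_nhds hlim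
      (fun _ => zero_le) hdist
  · refine eq_of_dL_eq_zero hL ?_
    have hne : dL L ψ φπ ≠ ⊤ := ne_top_of_le_ne_top
      (ENNReal.add_ne_top.2 ⟨dL_comm L φ₀ ψ ▸ hψd.ne, hfin.ne⟩) (dL_triangle L ψ φ₀ φπ)
    have h := dL_piF_le hLs hfΛ hΛt hπ hne
    rw [← funext hψ, ← funext hfix] at h
    by_contra h0
    exact h.not_gt (by simpa using ENNReal.mul_lt_mul_left h0 hne hΛ)
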